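/- arXiv:1908.05347 — 3 statements merged into one kernel-verified Lean document; each statement's English description precedes it below -/
import Mathlib

section
/- Suppose the set INL* := {u ∈ INL_ε | TAR u = ĵ} is nonempty, and let 𝒱 := {u : V | TAR u ≠ ĵ ∨ u ∈ INL*} (the node set in which every node of target ĵ lying outside INL* has been removed). Then for every tour u : ZMod M → V all of whose values lie in 𝒱, there exists r : ZMod M such that the cyclic rotation v := (fun k => u (k + r)) is a tour satisfying TAR (v 0) = ĵ, W0 (v 0) ≤ ε (so v is a feasible tour), and cost(v) = cost(u). (Theorem: Feasibility — the heuristic of Algorithm 4 always outputs a feasible solution of the discrete approximation.) -/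
/-- **Feasibility (Theorem 1).**
Discrete model of the discrete approximation: `M ≥ 1` targets (cyclic indexing
via `ZMod M`), a finite type `V` of sampled nodes, target assignment
`TAR : V → Fin M`, edge weights `W`, initial-maneuver times `W0`, threshold
`ε ≥ 0`, and a fixed target index `jhat`.  Suppose
`INL* := {u ∈ INL_ε | TAR u = jhat}` is nonempty and let
`𝒱 := {u | TAR u ≠ jhat ∨ u ∈ INL*}`.  Then every tour `u` with values in `𝒱`
admits a cyclic rotation `v := fun k => u (k + r)` that is a tour with
`TAR (v 0) = jhat`, `W0 (v 0) ≤ ε` (hence feasible), and the same closed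
cost. -/
theorem feasibility_of_heuristic
    {M : ℕ} [NeZero M] (hM : 1 ≤ M) {V : Type*} [Fintype V]
    (TAR : V → Fin M) (W : V → V → ℝ) (W0 : V → ℝ)
    (ε : ℝ) (hε : 0 ≤ ε) (jhat : Fin M)
    (hINLstar : ∃ u : V, (W0 u ≤ ε ∧ TAR u = jhat))
    (u : ZMod M → V)
    (htour : Function.Bijective (TAR ∘ u))
    (hvals : ∀ k : ZMod M,
      TAR (u k) ≠ jhat ∨ (W0 (u k) ≤ ε ∧ TAR (u k) = jhat)) :
    ∃ r : ZMod M,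
      Function.Bijective (TAR ∘ fun k : ZMod M => u (k + r)) ∧
      TAR (u (0 + r)) = jhat ∧
      W0 (u (0 + r)) ≤ ε ∧
      (∑ k : ZMod M, W (u (k + r)) (u (k + r + 1))) =
        ∑ k : ZMod M, W (u k) (u (k + 1)) := by
  obtain ⟨r, hr⟩ := htour.2 jhat
  have hr' : TAR (u r) = jhat := hr
  refine ⟨r, htour.comp (Equiv.addRight r).bijective, ?_, ?_, ?_⟩
  · rw [zero_add]; exact hr'
  · rw [zero_add]
    rcases hvals r with h | h
    · exact absurd hr' h
    · exact h.1
  · exact Equiv.sum_comp (Equiv.addRight r) (fun k : ZMod M => W (u k) (u (k + 1)))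
end

section
/- Suppose INL_ε is nonempty and there exists a target index ĵ such that either (i) every u ∈ INL_ε satisfies TAR u = ĵ, or (ii) every u ∈ V with TAR u = ĵ belongs to INL_ε. Set INL* := {u ∈ INL_ε | TAR u = ĵ} and 𝒱 := {u : V | TAR u ≠ ĵ ∨ u ∈ INL*}. If u : ZMod M → V is a tour with all values in 𝒱 whose closed cost is minimal among all tours with values in 𝒱 (an optimal solution of the GTSP on the restricted graph), and r : ZMod M is such that the rotation v := (fun k => u (k + r)) satisfies TAR (v 0) = ĵ, then v is a feasible tour and cost(v) ≤ cost(w) for every feasible tour w. (Theorem: Equivalence — optimal GTSP solutions on the restricted graph map, via cyclic permutation, to globally optimal solutions of the discrete approximation.) -/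
/-- **Equivalence (Theorem 2).**
Discrete model of the discrete approximation: `M ≥ 1` targets (cyclic indexing
via `ZMod M`), a finite type `V` of sampled nodes, target assignment
`TAR : V → Fin M`, edge weights `W`, initial-maneuver times `W0`, threshold
`ε ≥ 0`, and `INL_ε := {u | W0 u ≤ ε}`.  Suppose `INL_ε` is nonempty and there
is a target `jhat` such that either (i) every node of `INL_ε` is associated
with `jhat`, or (ii) every node associated with `jhat` lies in `INL_ε`.  With
`INL* := {u ∈ INL_ε | TAR u = jhat}` and `𝒱 := {u | TAR u ≠ jhat ∨ u ∈ INL*}`,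
if `u` is a tour with values in `𝒱` of minimal closed cost among all such
tours (optimal GTSP solution on the restricted graph), and the rotation
`v := fun k => u (k + r)` satisfies `TAR (v 0) = jhat`, then `v` is a feasible
tour whose closed cost is minimal among all feasible tours. -/
theorem equivalence_of_gtsp_and_discrete
    {M : ℕ} [NeZero M] (hM : 1 ≤ M) {V : Type*} [Fintype V]
    (TAR : V → Fin M) (W : V → V → ℝ) (W0 : V → ℝ)
    (ε : ℝ) (hε : 0 ≤ ε) (jhat : Fin M)
    (hINL : ∃ u : V, W0 u ≤ ε)
    (hcond : (∀ u : V, W0 u ≤ ε → TAR u = jhat) ∨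
             (∀ u : V, TAR u = jhat → W0 u ≤ ε))
    (u : ZMod M → V)
    (htour : Function.Bijective (TAR ∘ u))
    (hvals : ∀ k : ZMod M,
      TAR (u k) ≠ jhat ∨ (W0 (u k) ≤ ε ∧ TAR (u k) = jhat))
    (hopt : ∀ u' : ZMod M → V,
      Function.Bijective (TAR ∘ u') →
      (∀ k : ZMod M,
        TAR (u' k) ≠ jhat ∨ (W0 (u' k) ≤ ε ∧ TAR (u' k) = jhat)) →
      (∑ k : ZMod M, W (u k) (u (k + 1))) ≤
        ∑ k : ZMod M, W (u' k) (u' (k + 1)))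
    (r : ZMod M)
    (hr : TAR (u (0 + r)) = jhat) :
    (Function.Bijective (TAR ∘ fun k : ZMod M => u (k + r)) ∧
      W0 (u (0 + r)) ≤ ε) ∧
    (∀ w : ZMod M → V,
      Function.Bijective (TAR ∘ w) → W0 (w 0) ≤ ε →
      (∑ k : ZMod M, W (u (k + r)) (u (k + r + 1))) ≤
        ∑ k : ZMod M, W (w k) (w (k + 1))) := by
  refine ⟨⟨htour.comp (Equiv.addRight r).bijective, ?_⟩, ?_⟩
  · rcases hvals (0 + r) with h | h
    · exact absurd hr h
    · exact h.1
  · intro w hw hw0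
    have hrot : (∑ k : ZMod M, W (u (k + r)) (u (k + r + 1))) =
        ∑ k : ZMod M, W (u k) (u (k + 1)) :=
      Equiv.sum_comp (Equiv.addRight r) (fun k : ZMod M => W (u k) (u (k + 1)))
    rw [hrot]
    refine hopt w hw fun k => ?_
    by_cases hk : TAR (w k) = jhat
    · refine Or.inr ⟨?_, hk⟩
      rcases hcond with h | h
      · have h0 : k = 0 := hw.1 (hk.trans (h _ hw0).symm)
        rw [h0]
        exact hw0
      · exact h _ hk
    · exact Or.inl hk
end

section
/- Resolution completeness of dense sampling: let X be a metric space, S ⊆ X, f : X → ℝ, and suppose L ∈ ℝ satisfies L ≤ f x for all x ∈ S and L = f x* for some x* ∈ S at which f is continuous (the non-degeneracy assumption). Let A : ℕ → Set X be a sampling procedure with A N ⊆ S and A N nonempty for every N, and which is dense at x*: for every open set U containing x*, the intersection A N ∩ U is nonempty for all sufficiently large N. Then the sampled optimal values converge to the true optimal value: Tendsto (fun N => sInf (f '' A N)) atTop (𝓝 L). (This is the core convergence argument of the Resolution Completeness theorem: under non-degeneracy, the tour lengths produced from increasingly fine samplings approach the length of an optimal solution of the continuous problem.) -/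
open Filter Topology

/-- **Resolution completeness of dense sampling (core convergence argument of
Theorem 4).**  Let `X` be a metric space, `S ⊆ X` the feasible set, and
`f : X → ℝ` the tour-length functional.  Suppose `L` is a lower bound of `f`
on `S` attained at some `x* ∈ S` at which `f` is continuous (non-degeneracy).
If `A : ℕ → Set X` is a sampling procedure with `A N ⊆ S` nonempty for every
`N`, and which is dense at `x*` (every open neighborhood of `x*` eventually
contains a sample point), then the sampled optimal values `sInf (f '' A N)`
converge to the true optimal value `L`. -/
theorem resolution_completeness_of_dense_sampling
    {X : Type*} [MetricSpace X] (S : Set X) (f : X → ℝ) (L : ℝ)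
    (hL : ∀ x ∈ S, L ≤ f x)
    (xstar : X) (hxS : xstar ∈ S) (hfx : f xstar = L)
    (hcont : ContinuousAt f xstar)
    (A : ℕ → Set X)
    (hAS : ∀ N, A N ⊆ S)
    (hAne : ∀ N, (A N).Nonempty)
    (hdense : ∀ U : Set X, IsOpen U → xstar ∈ U →
      ∀ᶠ N in atTop, (A N ∩ U).Nonempty) :
    Tendsto (fun N => sInf (f '' A N)) atTop (𝓝 L) := by
  have hlb : ∀ N, L ∈ lowerBounds (f '' A N) := by
    rintro N _ ⟨x, hx, rfl⟩
    exact hL x (hAS N hx)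
  refine tendsto_order.2 ⟨fun a ha => Eventually.of_forall fun N => ?_, fun a ha => ?_⟩
  · exact lt_of_lt_of_le ha (le_csInf ((hAne N).image f) (hlb N))
  · have h1 : ∀ᶠ x in 𝓝 xstar, f x < a := hcont.eventually (Iio_mem_nhds (hfx ▸ ha))
    obtain ⟨U, hU, hUo, hxU⟩ := eventually_nhds_iff.1 h1
    filter_upwards [hdense U hUo hxU] with N hN
    obtain ⟨x, hxA, hxU'⟩ := hN
    exact lt_of_le_of_lt (csInf_le ⟨L, hlb N⟩ ⟨x, hxA, rfl⟩) (hU x hxU')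
end
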